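/- arXiv:1106.3421 — 2 statements merged into one kernel-verified Lean document; each statement's English description precedes it below -/
import Mathlib

section
/- Let N be a positive integer and 1 ≤ s ≤ N. (i) If s > N/2, then S = [1,s] is the unique s-element subset of [1,N] with r(S) = s(s−1)/2. (ii) If k is a positive integer with ks ≤ N < (k+1)s, then there are exactly k s-element subsets S of [1,N] with r(S) = s(s−1)/2, namely the sets S = {x_1, 2x_1, ..., s·x_1} for 1 ≤ x_1 ≤ k. -/
/-- `r(S)`: the number of ordered pairs `(x,y) ∈ S × S` with `x + y ∈ S`. -/
def rval (S : Finset ℕ) : ℕ :=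
  ((S ×ˢ S).filter (fun p => p.1 + p.2 ∈ S)).card

/-- The pairs `x < z` from an `s`-set number `s(s-1)/2`. -/
theorem card_filter_lt_product (S : Finset ℕ) :
    ((S ×ˢ S).filter (fun p => p.1 < p.2)).card = S.card * (S.card - 1) / 2 := by
  have hunion : S.offDiag = (S ×ˢ S).filter (fun p => p.1 < p.2) ∪
      (S ×ˢ S).filter (fun p => p.2 < p.1) := by
    ext ⟨x, y⟩
    simp only [Finset.mem_offDiag, Finset.mem_union, Finset.mem_filter, Finset.mem_product]
    grind
  have hdisj : Disjoint ((S ×ˢ S).filter (fun p => p.1 < p.2))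
      ((S ×ˢ S).filter (fun p => p.2 < p.1)) := by
    rw [Finset.disjoint_filter]
    intro p _ h
    exact h.le.not_gt
  have hswap : ((S ×ˢ S).filter (fun p => p.1 < p.2)).card =
      ((S ×ˢ S).filter (fun p => p.2 < p.1)).card := by
    refine Finset.card_nbij' Prod.swap Prod.swap ?_ ?_ ?_ ?_ <;> intro p <;> simp <;> tauto
  have hcard := congrArg Finset.card hunion
  rw [Finset.card_union_of_disjoint hdisj, ← hswap, Finset.offDiag_card] at hcard
  rw [Nat.mul_sub, mul_one]
  omega

/-- `r(S)` counts the pairs `x < z` in `S` whose difference lies in `S`. -/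
theorem rval_eq_card_sub_mem {S : Finset ℕ} (hpos : ∀ x ∈ S, 0 < x) :
    rval S = ((S ×ˢ S).filter (fun p => p.1 < p.2 ∧ p.2 - p.1 ∈ S)).card := by
  refine Finset.card_nbij' (fun p => (p.1, p.1 + p.2)) (fun p => (p.1, p.2 - p.1)) ?_ ?_ ?_ ?_
  · rintro ⟨x, y⟩ h
    simp only [Finset.coe_filter, Finset.mem_product, Set.mem_ofPred_eq] at h ⊢
    have := hpos y h.1.2
    simp [h]
    omega
  · rintro ⟨x, z⟩ h
    simp only [Finset.coe_filter, Finset.mem_product, Set.mem_ofPred_eq] at h ⊢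
    rw [Nat.add_sub_cancel' h.2.1.le]
    tauto
  · rintro ⟨x, y⟩ h
    simp
  · rintro ⟨x, z⟩ h
    simp only [Finset.coe_filter, Finset.mem_product, Set.mem_ofPred_eq] at h
    simp [Nat.add_sub_cancel' h.2.1.le]

/-- A set of positive integers attains the maximal `r`-value exactly when it contains all the
positive differences of its elements. -/
theorem rval_eq_max_iff {S : Finset ℕ} (hpos : ∀ x ∈ S, 0 < x) :
    rval S = S.card * (S.card - 1) / 2 ↔ ∀ x ∈ S, ∀ z ∈ S, x < z → z - x ∈ S := by
  rw [rval_eq_card_sub_mem hpos, ← card_filter_lt_product, ← Finset.filter_filter,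
    Finset.card_filter_eq_iff]
  simp only [Finset.mem_filter, Finset.mem_product, Prod.forall]
  exact ⟨fun h x hx z hz hlt => h x z ⟨⟨hx, hz⟩, hlt⟩,
    fun h x z hp => h x hp.1.1 z hp.1.2 hp.2⟩

theorem card_multiples (s : ℕ) {m : ℕ} (hm : 1 ≤ m) :
    ((Finset.range s).image (fun j => (j + 1) * m)).card = s := by
  rw [Finset.card_image_of_injective, Finset.card_range]
  intro a b hab
  have := Nat.eq_of_mul_eq_mul_right hm hab
  omega

/-- A nonempty set of positive integers containing all its positive differences consists of the
first multiples of its least element. -/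
theorem eq_multiples_of_sub_mem {S : Finset ℕ} (hne : S.Nonempty) (hpos : ∀ x ∈ S, 0 < x)
    (hsub : ∀ x ∈ S, ∀ z ∈ S, x < z → z - x ∈ S) :
    ∃ m, 1 ≤ m ∧ S = (Finset.range S.card).image (fun j => (j + 1) * m) := by
  obtain ⟨m, hm, hmin⟩ := S.exists_minimal hne
  have hm0 := hpos m hm
  have hle : ∀ z ∈ S, m ≤ z := fun z hz => by
    by_contra! h
    exact absurd (hmin hz h.le) (by omega)
  have key : ∀ z, z ∈ S → ∃ j, z = (j + 1) * m ∧ ∀ i ≤ j, (i + 1) * m ∈ S := by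
    intro z
    induction z using Nat.strong_induction_on with
    | _ z ih =>
      intro hz
      rcases (hle z hz).eq_or_lt with rfl | hlt
      · refine ⟨0, by simp, fun i hi => ?_⟩
        obtain rfl : i = 0 := by omega
        simpa using hm
      · obtain ⟨j, hj, hall⟩ := ih (z - m) (by omega) (hsub m hm z hz hlt)
        have hz' : z = (j + 1 + 1) * m := by
          rw [add_one_mul (j + 1) m]
          omega
        refine ⟨j + 1, hz', fun i hi => ?_⟩
        rcases Nat.le_succ_iff.mp hi with h | rfl
        · exact hall i h
        · exact hz' ▸ hz
  obtain ⟨n, hn, hall⟩ := key _ (S.max'_mem hne)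
  have hS : S = (Finset.range (n + 1)).image (fun j => (j + 1) * m) := by
    ext z
    simp only [Finset.mem_image, Finset.mem_range]
    constructor
    · intro hz
      obtain ⟨j, rfl, -⟩ := key z hz
      have := S.le_max' _ hz
      rw [hn] at this
      exact ⟨j, by have := Nat.le_of_mul_le_mul_right this hm0; omega, rfl⟩
    · rintro ⟨j, hj, rfl⟩
      exact hall j (by omega)
  have hcard : S.card = n + 1 := by
    rw [hS, card_multiples _ hm0]
  exact ⟨m, hm0, by rw [hcard]; exact hS⟩

theorem rval_multiples (s : ℕ) {m : ℕ} (hm : 1 ≤ m) :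
    rval ((Finset.range s).image (fun j => (j + 1) * m)) = s * (s - 1) / 2 := by
  have h := (rval_eq_max_iff (S := (Finset.range s).image (fun j => (j + 1) * m)) ?_).mpr ?_
  · rwa [card_multiples s hm] at h
  · simp only [Finset.mem_image, Finset.mem_range]
    rintro x ⟨j, -, rfl⟩
    positivity
  · simp only [Finset.mem_image, Finset.mem_range]
    rintro x ⟨i, hi, rfl⟩ z ⟨j, hj, rfl⟩ hlt
    have hij := Nat.lt_of_mul_lt_mul_right hlt
    refine ⟨j - i - 1, by omega, ?_⟩
    rw [← Nat.sub_mul]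
    congr 1
    omega

theorem rval_eq_max_iff_exists_multiples {N s k : ℕ} (hs : 1 ≤ s) (hNk : N < (k + 1) * s)
    {S : Finset ℕ} (hS : S ⊆ Finset.Icc 1 N) (hcard : S.card = s) :
    rval S = s * (s - 1) / 2 ↔
      ∃ m, 1 ≤ m ∧ m ≤ k ∧ S = (Finset.range s).image (fun j => (j + 1) * m) := by
  constructor
  · intro h
    have hpos : ∀ x ∈ S, 0 < x := fun x hx => (Finset.mem_Icc.mp (hS hx)).1
    rw [← hcard, rval_eq_max_iff hpos] at h
    obtain ⟨m, hm, hSm⟩ := eq_multiples_of_sub_mem (Finset.card_pos.mp (by omega)) hpos h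
    rw [hcard] at hSm
    refine ⟨m, hm, ?_, hSm⟩
    have hmem : s * m ∈ S := by
      rw [hSm]
      exact Finset.mem_image.mpr
        ⟨s - 1, Finset.mem_range.mpr (by omega), by rw [Nat.sub_add_cancel hs]⟩
    have hlt := (Finset.mem_Icc.mp (hS hmem)).2.trans_lt hNk
    rw [mul_comm] at hlt
    exact Nat.lt_succ_iff.mp (Nat.lt_of_mul_lt_mul_right hlt)
  · rintro ⟨m, hm, -, rfl⟩
    exact rval_multiples s hm

theorem multiples_injective {s : ℕ} (hs : 1 ≤ s) :
    Function.Injective (fun m => (Finset.range s).image (fun j => (j + 1) * m)) := by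
  have hle : ∀ a b : ℕ, (Finset.range s).image (fun j => (j + 1) * a) =
      (Finset.range s).image (fun j => (j + 1) * b) → b ≤ a := by
    intro a b h
    have hmem : a ∈ (Finset.range s).image (fun j => (j + 1) * b) := by
      rw [← h]
      exact Finset.mem_image.mpr ⟨0, Finset.mem_range.mpr hs, by simp⟩
    obtain ⟨j, -, rfl⟩ := Finset.mem_image.mp hmem
    exact Nat.le_mul_of_pos_left b j.succ_pos
  exact fun a b h => le_antisymm (hle b a h.symm) (hle a b h)

theorem multiples_one (s : ℕ) :
    (Finset.range s).image (fun j => (j + 1) * 1) = Finset.Icc 1 s := by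
  ext x
  simp only [Finset.mem_image, Finset.mem_range, Finset.mem_Icc, mul_one]
  exact ⟨by rintro ⟨j, hj, rfl⟩; omega, fun h => ⟨x - 1, by omega, by omega⟩⟩

theorem multiples_subset_Icc {N s k m : ℕ} (hkN : k * s ≤ N) (hm : 1 ≤ m) (hmk : m ≤ k) :
    (Finset.range s).image (fun j => (j + 1) * m) ⊆ Finset.Icc 1 N := by
  intro x hx
  obtain ⟨j, hj, rfl⟩ := Finset.mem_image.mp hx
  have hjs : j + 1 ≤ s := Finset.mem_range.mp hj
  refine Finset.mem_Icc.mpr ⟨Nat.mul_pos j.succ_pos hm, ?_⟩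
  calc (j + 1) * m ≤ s * k := Nat.mul_le_mul hjs hmk
    _ ≤ N := by rwa [mul_comm]

/-- Corollary 3.2: (i) if `s > N/2` then `[1,s]` is the unique `s`-set in `[1,N]`
attaining the maximal `r`-value `s(s-1)/2`; (ii) if `ks ≤ N < (k+1)s` then there are
exactly `k` such sets, namely `{x₁, 2x₁, …, s·x₁}` for `1 ≤ x₁ ≤ k`. -/
theorem max_rval_sets (N s : ℕ) (hN : 0 < N) (hs : 1 ≤ s) (hsN : s ≤ N) :
    (2 * s > N →
      ∀ S : Finset ℕ, S ⊆ Finset.Icc 1 N → S.card = s →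
        (rval S = s * (s - 1) / 2 ↔ S = Finset.Icc 1 s)) ∧
    (∀ k : ℕ, 0 < k → k * s ≤ N → N < (k + 1) * s →
      (((Finset.Icc 1 N).powerset.filter
          (fun S => S.card = s ∧ rval S = s * (s - 1) / 2)).card = k ∧
        ∀ S : Finset ℕ, S ⊆ Finset.Icc 1 N → S.card = s →
          (rval S = s * (s - 1) / 2 ↔
            ∃ x₁, 1 ≤ x₁ ∧ x₁ ≤ k ∧
              S = (Finset.range s).image (fun j => (j + 1) * x₁)))) := by
  refine ⟨fun h S hS hcard => ?_, fun k _ hkN hNk => ⟨?_, fun S hS hcard =>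
    rval_eq_max_iff_exists_multiples hs hNk hS hcard⟩⟩
  · rw [rval_eq_max_iff_exists_multiples (k := 1) hs (by omega) hS hcard, ← multiples_one]
    constructor
    · rintro ⟨m, hm, hm', rfl⟩
      rw [le_antisymm hm' hm]
    · exact fun h => ⟨1, le_rfl, le_rfl, h⟩
  · have himage : (Finset.Icc 1 N).powerset.filter
          (fun S => S.card = s ∧ rval S = s * (s - 1) / 2) =
        (Finset.Icc 1 k).image (fun m => (Finset.range s).image (fun j => (j + 1) * m)) := by
      ext S
      rw [Finset.mem_filter, Finset.mem_powerset, Finset.mem_image]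
      constructor
      · rintro ⟨hS, hcard, hr⟩
        obtain ⟨m, hm, hmk, rfl⟩ := (rval_eq_max_iff_exists_multiples hs hNk hS hcard).mp hr
        exact ⟨m, Finset.mem_Icc.mpr ⟨hm, hmk⟩, rfl⟩
      · rintro ⟨m, hmem, rfl⟩
        obtain ⟨hm, hmk⟩ := Finset.mem_Icc.mp hmem
        exact ⟨multiples_subset_Icc hkN hm hmk, card_multiples s hm, rval_multiples s hm⟩
    rw [himage, Finset.card_image_of_injective _ (multiples_injective hs), Nat.card_Icc,
      Nat.add_sub_cancel]
end

section
/- Let N be a positive integer and let S ⊆ [1,N] with s = |S| ≥ (N+1)/2 and r(S) = f_{s,N} (the minimum value over s-element subsets of [1,N]). Then: if s > (N+1)/2 or N is even, then S = [N−s+1, N]; if N is odd and s = (N+1)/2, then S = [N−s+1, N] or S = {1, 3, 5, ..., 2(N−s)+1}. -/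
open Finset in
/-- Removing the largest possible element `N` from `S ⊆ [1,N]` loses at least the
representations `N = x + (N - x)`. -/
theorem rval_erase_add_le {N : ℕ} {S : Finset ℕ} (hS : S ⊆ Icc 1 N) (hN : N ∈ S) :
    rval (S.erase N) + ((S.erase N).filter (fun x => N - x ∈ S.erase N)).card ≤ rval S := by
  set U := (S.erase N).filter (fun x => N - x ∈ S.erase N) with hU
  have hinj : Function.Injective (fun x : ℕ => (x, N - x)) := fun x y h => (Prod.ext_iff.1 h).1
  rw [← card_image_of_injective U hinj]
  unfold rval
  rw [← card_union_of_disjoint]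
  · apply card_le_card
    intro p hp
    simp only [mem_union, mem_filter, mem_product, mem_image, mem_erase, hU] at hp ⊢
    rcases hp with hp | ⟨x, hx, rfl⟩
    · tauto
    · have hx' := mem_Icc.1 (hS hx.1.2)
      refine ⟨⟨hx.1.2, hx.2.2⟩, ?_⟩
      simpa [Nat.add_sub_cancel' hx'.2] using hN
  · rw [disjoint_left]
    intro p hp hq
    simp only [mem_filter, mem_product, mem_image, mem_erase, hU] at hp hq
    obtain ⟨x, hx, rfl⟩ := hq
    have hx' := mem_Icc.1 (hS hx.1.2)
    exact hp.2.1 (Nat.add_sub_cancel' hx'.2)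

open Finset in
/-- Pigeonhole bound for the number of representations of `N` as a sum of two elements of `S`. -/
theorem le_card_filter_sub_mem {N t : ℕ} {S : Finset ℕ} (hS : S ⊆ Icc 1 N) (hN : N ∈ S)
    (hcard : S.card + t = N) :
    N - 1 - 2 * t ≤ ((S.erase N).filter (fun x => N - x ∈ S.erase N)).card := by
  set S' := S.erase N with hS'
  have hmem : ∀ x ∈ S', 1 ≤ x ∧ x < N := fun x hx => by
    have h1 := mem_Icc.1 (hS (mem_of_mem_erase hx))
    have h2 := ne_of_mem_erase hx
    omega
  have hR : (S'.image (fun x => N - x)).card = S'.card := by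
    apply card_image_of_injOn
    intro x hx y hy hxy
    have hx := hmem x hx
    have hy := hmem y hy
    simp only at hxy
    omega
  have hunion : (S' ∪ S'.image (fun x => N - x)).card ≤ N - 1 := by
    have : S' ∪ S'.image (fun x => N - x) ⊆ Icc 1 (N - 1) := by
      intro x hx
      simp only [mem_union, mem_image, mem_Icc] at hx ⊢
      rcases hx with hx | ⟨y, hy, rfl⟩
      · have := hmem x hx; omega
      · have := hmem y hy; omega
    simpa using card_le_card this
  have hinter : S' ∩ S'.image (fun x => N - x) ⊆ S'.filter (fun x => N - x ∈ S') := by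
    intro x hx
    simp only [mem_inter, mem_image, mem_filter] at hx ⊢
    obtain ⟨hx, y, hy, rfl⟩ := hx
    have := hmem y hy
    exact ⟨hx, by rwa [Nat.sub_sub_self this.2.le]⟩
  have h1 := card_le_card hinter
  have h2 := card_union_add_card_inter S' (S'.image (fun x => N - x))
  have h3 : S'.card = S.card - 1 := card_erase_of_mem hN
  omega

theorem erase_subset_Icc_pred {N : ℕ} {S : Finset ℕ} (hS : S ⊆ Finset.Icc 1 (N + 1)) :
    S.erase (N + 1) ⊆ Finset.Icc 1 N := by
  intro x hx
  have h1 := Finset.mem_Icc.1 (hS (Finset.mem_of_mem_erase hx))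
  have h2 := Finset.ne_of_mem_erase hx
  rw [Finset.mem_Icc]
  omega

theorem choose_two_succ (n : ℕ) : (n + 1).choose 2 = n + n.choose 2 := by
  rw [Nat.choose_succ_succ' _ 1, Nat.choose_one_right]

/-- Lower bound for `rval S` when `S` misses exactly `t` elements of `[1,N]`. -/
theorem choose_two_le_rval (N : ℕ) : ∀ (t : ℕ) (S : Finset ℕ), S ⊆ Finset.Icc 1 N →
    S.card + t = N → (N - 2 * t).choose 2 ≤ rval S := by
  induction N with
  | zero => simp
  | succ N ih =>
    intro t S hS hcard
    have hsub := erase_subset_Icc_pred hS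
    by_cases hN : N + 1 ∈ S
    · have h1 := rval_erase_add_le hS hN
      have h2 := le_card_filter_sub_mem hS hN hcard
      have h3 : (S.erase (N + 1)).card = S.card - 1 := Finset.card_erase_of_mem hN
      have h4 := Finset.card_pos.2 ⟨_, hN⟩
      have h5 := ih t _ hsub (by omega)
      rcases le_or_gt (2 * t) N with h | h
      · have h6 : (N + 1 - 2 * t).choose 2 = (N - 2 * t) + (N - 2 * t).choose 2 := by
          rw [Nat.sub_add_comm h, choose_two_succ]
        omega
      · rw [Nat.choose_eq_zero_of_lt (by omega)]
        exact Nat.zero_le _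
    · rw [Finset.erase_eq_of_notMem hN] at hsub
      have h1 := Finset.card_le_card hsub
      rw [Nat.card_Icc] at h1
      exact (Nat.choose_le_choose 2 (by omega)).trans (ih (t - 1) S hsub (by omega))

open Finset in
theorem rval_Icc_le (N t : ℕ) : rval (Icc (t + 1) N) ≤ (N - 2 * t).choose 2 := by
  have h : ((range (N - 2 * t)).sigma fun i => range i).card = (N - 2 * t).choose 2 := by
    simp only [card_sigma, card_range]
    rw [sum_range_id, Nat.choose_two_right]
  rw [← h]
  unfold rval
  apply card_le_card_of_injOn (fun p => ⟨p.1 + p.2 - 2 * t - 1, p.1 - t - 1⟩)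
  · intro p hp
    simp only [coe_filter, Set.mem_ofPred_eq, mem_product, mem_Icc] at hp
    simp only [coe_sigma, Set.mem_sigma_iff, mem_coe, mem_range]
    omega
  · rintro ⟨x, y⟩ hp ⟨x', y'⟩ hq hpq
    simp only [coe_filter, Set.mem_ofPred_eq, mem_product, mem_Icc] at hp hq
    simp only [Sigma.mk.injEq, heq_eq_eq] at hpq
    rw [Prod.mk.injEq]
    omega

open Finset in
/-- Sum-free sets of `t + 1` elements in `[1, 2t + 1]`. -/
theorem eq_Icc_or_odds_of_sumFree {t : ℕ} {S : Finset ℕ} (hS : S ⊆ Icc 1 (2 * t + 1))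
    (hcard : S.card = t + 1) (hfree : ∀ x ∈ S, ∀ y ∈ S, x + y ∉ S) :
    S = Icc (t + 1) (2 * t + 1) ∨ S = (range (t + 1)).image (fun k => 2 * k + 1) := by
  have hne : S.Nonempty := card_pos.1 (by omega)
  obtain ⟨a, ha, hmin⟩ : ∃ a ∈ S, ∀ x ∈ S, a ≤ x := ⟨S.min' hne, S.min'_mem hne, S.min'_le⟩
  have ha1 := mem_Icc.1 (hS ha)
  have hcompl : (S.erase a).image (fun x => x - a) = Icc 1 (2 * t + 1) \ S := by
    apply eq_of_subset_of_card_le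
    · intro y hy
      obtain ⟨x, hx, rfl⟩ := mem_image.1 hy
      have hxS := mem_of_mem_erase hx
      have h1 := hmin x hxS
      have h2 := ne_of_mem_erase hx
      have h3 := mem_Icc.1 (hS hxS)
      rw [mem_sdiff, mem_Icc]
      refine ⟨by omega, fun h => hfree _ h a ha ?_⟩
      rwa [Nat.sub_add_cancel h1]
    · rw [card_sdiff_of_subset hS, Nat.card_Icc, card_image_of_injOn, card_erase_of_mem ha]
      · omega
      · intro x hx y hy hxy
        have h1 := hmin x (mem_of_mem_erase hx)
        have h2 := hmin y (mem_of_mem_erase hy)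
        simp only at hxy
        omega
  have hadd : ∀ y, 1 ≤ y → y ≤ 2 * t + 1 → y ∉ S → y + a ∈ S := by
    intro y h1 h2 h3
    have : y ∈ Icc 1 (2 * t + 1) \ S := mem_sdiff.2 ⟨mem_Icc.2 ⟨h1, h2⟩, h3⟩
    rw [← hcompl] at this
    obtain ⟨x, hx, rfl⟩ := mem_image.1 this
    have hxS := mem_of_mem_erase hx
    rwa [Nat.sub_add_cancel (hmin x hxS)]
  rcases le_or_gt (2 * a) (2 * t + 1) with h2a | h2a
  · obtain rfl : a = 1 := by
      by_contra hne1
      have hlow : ∀ y, 1 ≤ y → y < a → y + a ∈ S := fun y h1 h2 =>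
        hadd y h1 (by omega) fun h => absurd (hmin y h) (by omega)
      have h3a := hadd (2 * a) (by omega) h2a (by rw [two_mul]; exact hfree a ha a ha)
      refine hfree _ (hlow 1 le_rfl (by omega)) _ (hlow (a - 1) (by omega) (by omega)) ?_
      convert h3a using 1
      omega
    right
    symm
    apply eq_of_subset_of_card_le
    · have hodd : ∀ k, k < t + 1 → 2 * k + 1 ∈ S := by
        intro k
        induction k with
        | zero => intro _; exact ha
        | succ k ih =>
          intro hk
          exact hadd (2 * k + 2) (by omega) (by omega) (hfree _ (ih (by omega)) 1 ha)
      intro x hx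
      obtain ⟨k, hk, rfl⟩ := mem_image.1 hx
      exact hodd k (mem_range.1 hk)
    · rw [card_image_of_injective _ (fun x y h => by simpa using h), card_range, hcard]
  · left
    apply eq_of_subset_of_card_le
    · intro x hx
      have h1 := hmin x hx
      have h2 := mem_Icc.1 (hS hx)
      rw [mem_Icc]
      omega
    · rw [Nat.card_Icc]
      omega

open Finset in
/-- The sets attaining the bound of `choose_two_le_rval`, where `t` counts the missing elements
and `N = 2t + 1 + k`. -/
theorem eq_Icc_or_odds_of_rval_le (t k : ℕ) : ∀ S : Finset ℕ, S ⊆ Icc 1 (2 * t + 1 + k) →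
    S.card = t + 1 + k → rval S ≤ (k + 1).choose 2 →
    S = Icc (t + 1) (2 * t + 1 + k) ∨
      k = 0 ∧ S = (range (t + 1)).image (fun k => 2 * k + 1) := by
  induction k with
  | zero =>
    intro S hS hcard hr
    have hr0 : rval S = 0 := by simpa using hr
    have hfree : ∀ x ∈ S, ∀ y ∈ S, x + y ∉ S := by
      intro x hx y hy hxy
      exact notMem_empty (x, y) (card_eq_zero.1 hr0 ▸ mem_filter.2 ⟨mem_product.2 ⟨hx, hy⟩, hxy⟩)
    simpa using eq_Icc_or_odds_of_sumFree hS hcard hfree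
  | succ k ih =>
    intro S hS hcard hr
    rw [← add_assoc] at hS ⊢
    have hsub := erase_subset_Icc_pred hS
    have hch : (k + 1 + 1).choose 2 = (k + 1) + (k + 1).choose 2 := choose_two_succ _
    by_cases hN : 2 * t + 1 + k + 1 ∈ S
    · have h1 := rval_erase_add_le hS hN
      have h2 := le_card_filter_sub_mem hS hN (t := t) (by omega)
      have h3 : (S.erase (2 * t + 1 + k + 1)).card = S.card - 1 := card_erase_of_mem hN
      left
      have hext : S.erase (2 * t + 1 + k + 1) = Icc (t + 1) (2 * t + 1 + k) →
          S = Icc (t + 1) (2 * t + 1 + k + 1) := by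
        intro h
        rw [← insert_erase hN, h]
        ext x
        simp only [mem_insert, mem_Icc]
        omega
      rcases ih _ hsub (by omega) (by omega) with h | ⟨rfl, h⟩
      · exact hext h
      · rcases Nat.eq_zero_or_pos t with rfl | ht
        · exact hext (by rw [h]; rfl)
        · exfalso
          have hpair : ({1, 2 * t + 1} : Finset ℕ) ⊆ (S.erase (2 * t + 1 + 0 + 1)).filter
              (fun x => 2 * t + 1 + 0 + 1 - x ∈ S.erase (2 * t + 1 + 0 + 1)) := by
            rw [h]
            intro x hx
            simp only [mem_insert, mem_singleton] at hx
            simp only [mem_filter, mem_image, mem_range]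
            rcases hx with rfl | rfl
            · exact ⟨⟨0, by omega, by omega⟩, ⟨t, by omega, by omega⟩⟩
            · exact ⟨⟨t, by omega, by omega⟩, ⟨0, by omega, by omega⟩⟩
          have h4 := card_le_card hpair
          rw [card_pair (by omega)] at h4
          have h5 : (0 + 1 + 1).choose 2 = 1 := rfl
          omega
    · exfalso
      rw [erase_eq_of_notMem hN] at hsub
      have h1 := card_le_card hsub
      rw [Nat.card_Icc] at h1
      have h2 := choose_two_le_rval _ (t - 1) S hsub (by omega)
      rw [show 2 * t + 1 + k - 2 * (t - 1) = k + 1 + 1 + 1 by omega,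
        choose_two_succ, hch] at h2
      omega

/-- Theorem 3.4: structure of the `s`-sets in `[1,N]` with `s ≥ (N+1)/2` attaining
the minimal `r`-value. -/
theorem min_rval_sets (N s : ℕ) (hN : 0 < N) (S : Finset ℕ)
    (hS : S ⊆ Finset.Icc 1 N) (hcard : S.card = s) (hsN : s ≤ N)
    (hbig : N + 1 ≤ 2 * s)
    (hmin : ∀ T : Finset ℕ, T ⊆ Finset.Icc 1 N → T.card = s → rval S ≤ rval T) :
    ((N + 1 < 2 * s ∨ Even N) → S = Finset.Icc (N - s + 1) N) ∧
    ((Odd N ∧ 2 * s = N + 1) →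
      S = Finset.Icc (N - s + 1) N ∨
        S = (Finset.range (N - s + 1)).image (fun k => 2 * k + 1)) := by
  have hle := hmin (Finset.Icc (N - s + 1) N)
    (Finset.Icc_subset_Icc_left (by omega)) (by rw [Nat.card_Icc]; omega)
  obtain ⟨t, rfl⟩ : ∃ t, N = s + t := Nat.exists_eq_add_of_le hsN
  obtain ⟨k, rfl⟩ : ∃ k, s = t + 1 + k := Nat.exists_eq_add_of_le (by omega)
  have ht : t + 1 + k + t - (t + 1 + k) = t := by omega
  have hN' : t + 1 + k + t = 2 * t + 1 + k := by omega
  rw [ht] at hle ⊢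
  rw [hN'] at hle hS ⊢
  have hub := rval_Icc_le (2 * t + 1 + k) t
  rw [show 2 * t + 1 + k - 2 * t = k + 1 by omega] at hub
  have key := eq_Icc_or_odds_of_rval_le t k S hS hcard (hle.trans hub)
  refine ⟨fun h => ?_, fun _ => key.imp_right And.right⟩
  refine key.resolve_right fun hk => ?_
  rcases h with h | ⟨m, h⟩ <;> omega
end
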